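/- arXiv:0706.3837 — 9 statements merged into one kernel-verified Lean document; each statement's English description precedes it below -/
import Mathlib

section
/- Let V be a finite-dimensional real vector space and let h and k be antisymmetric bilinear forms on V. Then the Kulkarni product h⊠k is a curvature-type 4-linear form on V (antisymmetric in its first two arguments, antisymmetric in its last two arguments, and invariant under exchanging the first pair of arguments with the second pair), and b(h⊠k) = −2·b(h⊙k). -/
noncomputable section

namespace Stmt

variable {V : Type*}

/-- The symmetric product `h⊙k` of two bilinear forms. -/
def symProd (h k : V → V → ℝ) : V → V → V → V → ℝ :=
  fun X Y Z W => h X Y * k Z W + h Z W * k X Y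

/-- The Kulkarni product `h⊠k` of two bilinear forms. -/
def kulk (h k : V → V → ℝ) : V → V → V → V → ℝ :=
  fun X Y Z W => symProd h k X Z Y W - symProd h k X W Y Z

/-- The Bianchi map `b(Q)`. -/
def bianchi (Q : V → V → V → V → ℝ) : V → V → V → V → ℝ :=
  fun X Y Z W => Q X Y Z W + Q Z X Y W + Q Y Z X W

/-- A 4-linear form is of curvature type if it is antisymmetric in its first two
arguments, antisymmetric in its last two arguments, and invariant under exchanging
the first pair with the second pair. -/
def CurvType (Q : V → V → V → V → ℝ) : Prop :=
  (∀ X Y Z W, Q Y X Z W = - Q X Y Z W) ∧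
  (∀ X Y Z W, Q X Y W Z = - Q X Y Z W) ∧
  (∀ X Y Z W, Q Z W X Y = Q X Y Z W)

theorem stmt1 [AddCommGroup V] [Module ℝ V] [FiniteDimensional ℝ V]
    (h k : V →ₗ[ℝ] V →ₗ[ℝ] ℝ)
    (hh : ∀ X Y : V, h X Y = - h Y X) (hk : ∀ X Y : V, k X Y = - k Y X) :
    CurvType (kulk (fun X Y => h X Y) (fun X Y => k X Y)) ∧
    ∀ X Y Z W : V,
      bianchi (kulk (fun X Y => h X Y) (fun X Y => k X Y)) X Y Z W
        = -2 * bianchi (symProd (fun X Y => h X Y) (fun X Y => k X Y)) X Y Z W := by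
  refine ⟨⟨fun X Y Z W => ?_, fun X Y Z W => ?_, fun X Y Z W => ?_⟩, fun X Y Z W => ?_⟩
  · simp only [kulk, symProd]
    ring
  · simp only [kulk, symProd]
    ring
  · simp only [kulk, symProd]
    rw [hh Z X, hh W Y, hh Z Y, hh W X, hk Z X, hk W Y, hk Z Y, hk W X]
    ring
  · simp only [bianchi, kulk, symProd]
    rw [hh Z X, hh Z Y, hh Y X, hk Z X, hk Z Y, hk Y X]
    ring

end Stmt
end
end

section
/- For every curvature-type 4-linear form Q on V, one has ⟨(g⊠g)^+, Q⟩ = tr (Q^+)̂ and ⟨(g⊠g)^−, Q⟩ = tr (Q^−)̂. -/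
noncomputable section
open Finset RealInnerProductSpace

namespace Stmt

variable {V : Type*}

variable [NormedAddCommGroup V] [InnerProductSpace ℝ V]

/-- The inner product `g` as a bilinear form. -/
def gF : V → V → ℝ := fun X Y => ⟪X, Y⟫

/-- The fundamental 2-form `ω(X,Y) = ⟨JX,Y⟩`. -/
def omF (J : V →ₗ[ℝ] V) : V → V → ℝ := fun X Y => ⟪J X, Y⟫

/-- The torsion form `A(X,Y) = ⟨τX,Y⟩`. -/
def aF (τ : V →ₗ[ℝ] V) : V → V → ℝ := fun X Y => ⟪τ X, Y⟫

/-- The form `B(X,Y) = ⟨JτX,Y⟩`. -/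
def bF (J τ : V →ₗ[ℝ] V) : V → V → ℝ := fun X Y => ⟪J (τ X), Y⟫

/-- The J-invariant part `Q^+` of a 4-linear form. -/
def qPlus (J : V →ₗ[ℝ] V) (Q : V → V → V → V → ℝ) : V → V → V → V → ℝ :=
  fun X Y Z W => (1/4) * (Q X Y Z W + Q (J X) (J Y) Z W + Q X Y (J Z) (J W)
    + Q (J X) (J Y) (J Z) (J W))

/-- The J-anti-invariant part `Q^-` of a 4-linear form. -/
def qMinus (J : V →ₗ[ℝ] V) (Q : V → V → V → V → ℝ) : V → V → V → V → ℝ :=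
  fun X Y Z W => (1/4) * (Q X Y Z W - Q (J X) (J Y) Z W - Q X Y (J Z) (J W)
    + Q (J X) (J Y) (J Z) (J W))

/-- `tr Q̂ = (1/2)·Σ_{i,j} Q(e_i,e_j,e_i,e_j)`. -/
def trHat {n : ℕ} (e : OrthonormalBasis (Fin n) ℝ V) (Q : V → V → V → V → ℝ) : ℝ :=
  (1/2) * ∑ i, ∑ j, Q (e i) (e j) (e i) (e j)

/-- The Ricci contraction `c(Q)(X,Y) = Σ_i Q(e_i,X,e_i,Y)`. -/
def ricciC {n : ℕ} (e : OrthonormalBasis (Fin n) ℝ V) (Q : V → V → V → V → ℝ) :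
    V → V → ℝ :=
  fun X Y => ∑ i, Q (e i) X (e i) Y

/-- The endomorphism `Q̂` of `Λ²V`, acting on antisymmetric bilinear forms by
`(Q̂γ)(X,Y) = (1/2)·Σ_{i,j} Q(e_i,e_j,X,Y)·γ(e_i,e_j)`. -/
def hatOp {n : ℕ} (e : OrthonormalBasis (Fin n) ℝ V) (Q : V → V → V → V → ℝ)
    (γ : V → V → ℝ) : V → V → ℝ :=
  fun X Y => (1/2) * ∑ i, ∑ j, Q (e i) (e j) X Y * γ (e i) (e j)

/-- The 4-linear form corresponding to the composition `P̂∘Q̂`. -/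
def hatComp {n : ℕ} (e : OrthonormalBasis (Fin n) ℝ V) (P Q : V → V → V → V → ℝ) :
    V → V → V → V → ℝ :=
  fun X Y Z W => (1/2) * ∑ k, ∑ l, Q X Y (e k) (e l) * P (e k) (e l) Z W

/-- The scalar product `⟨P,Q⟩ = (1/2)·tr(P̂∘Q̂)` of curvature-type forms. -/
def formInner {n : ℕ} (e : OrthonormalBasis (Fin n) ℝ V) (P Q : V → V → V → V → ℝ) : ℝ :=
  (1/2) * trHat e (hatComp e P Q)

section Helpers

variable {n : ℕ} {e : OrthonormalBasis (Fin n) ℝ V} {J : V →ₗ[ℝ] V}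

lemma inner_map_left_of_complex (hJ2 : ∀ X : V, J (J X) = -X)
    (hJO : ∀ X Y : V, ⟪J X, J Y⟫ = ⟪X, Y⟫) (X Y : V) : ⟪J X, Y⟫ = -⟪X, J Y⟫ := by
  have h := hJO X (J Y)
  rw [hJ2, inner_neg_right] at h
  linarith

/-- A linear form is recovered from its values on an orthonormal basis. -/
lemma sum_apply_mul_inner (e : OrthonormalBasis (Fin n) ℝ V) (f : V →ₗ[ℝ] ℝ) (X : V) :
    ∑ i, f (e i) * ⟪e i, X⟫ = f X := by
  conv_rhs => rw [← e.sum_repr' X]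
  simp [mul_comm]

/-- An orthogonal complex structure may be moved across a contraction, up to sign. -/
lemma sum_apply_map_left (e : OrthonormalBasis (Fin n) ℝ V) (hJ2 : ∀ X : V, J (J X) = -X)
    (hJO : ∀ X Y : V, ⟪J X, J Y⟫ = ⟪X, Y⟫) (B : V →ₗ[ℝ] V →ₗ[ℝ] ℝ) :
    ∑ i, B (J (e i)) (e i) = -∑ i, B (e i) (J (e i)) := by
  have hl (i : Fin n) : B (J (e i)) (e i) = ∑ k, B (e k) (e i) * ⟪e k, J (e i)⟫ :=
    (sum_apply_mul_inner e (B.flip (e i)) (J (e i))).symm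
  have hr (k : Fin n) : B (e k) (J (e k)) = ∑ i, B (e k) (e i) * ⟪e i, J (e k)⟫ :=
    (sum_apply_mul_inner e (B (e k)) (J (e k))).symm
  simp_rw [hl, hr]
  rw [Finset.sum_comm, ← Finset.sum_neg_distrib]
  refine Finset.sum_congr rfl fun k _ => ?_
  rw [← Finset.sum_neg_distrib]
  refine Finset.sum_congr rfl fun i _ => ?_
  rw [real_inner_comm, inner_map_left_of_complex hJ2 hJO]
  ring

lemma sum_apply_map_map (e : OrthonormalBasis (Fin n) ℝ V) (hJ2 : ∀ X : V, J (J X) = -X)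
    (hJO : ∀ X Y : V, ⟪J X, J Y⟫ = ⟪X, Y⟫) (B : V →ₗ[ℝ] V →ₗ[ℝ] ℝ) :
    ∑ i, B (J (e i)) (J (e i)) = ∑ i, B (e i) (e i) := by
  have h := sum_apply_map_left e hJ2 hJO (B.compl₂ J)
  simpa [hJ2] using h

lemma kulk_gF (X Y Z W : V) :
    kulk gF gF X Y Z W = 2 * (⟪X, Z⟫ * ⟪Y, W⟫ - ⟪X, W⟫ * ⟪Y, Z⟫) := by
  simp only [kulk, symProd, gF]
  ring

lemma kulk_gF_map_left (hJ2 : ∀ X : V, J (J X) = -X)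
    (hJO : ∀ X Y : V, ⟪J X, J Y⟫ = ⟪X, Y⟫) (X Y Z W : V) :
    kulk gF gF (J X) (J Y) Z W = kulk gF gF X Y (J Z) (J W) := by
  simp only [kulk_gF, inner_map_left_of_complex hJ2 hJO]
  ring

lemma kulk_gF_map (hJO : ∀ X Y : V, ⟪J X, J Y⟫ = ⟪X, Y⟫) (X Y Z W : V) :
    kulk gF gF (J X) (J Y) (J Z) (J W) = kulk gF gF X Y Z W := by
  simp only [kulk_gF, hJO]

lemma sum_apply_mul_inner_mul_inner (e : OrthonormalBasis (Fin n) ℝ V)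
    (B : V →ₗ[ℝ] V →ₗ[ℝ] ℝ) (Z W : V) :
    ∑ k, ∑ l, B (e k) (e l) * (⟪e k, Z⟫ * ⟪e l, W⟫) = B Z W := by
  have h (k : Fin n) :
      ∑ l, B (e k) (e l) * (⟪e k, Z⟫ * ⟪e l, W⟫) = B.flip W (e k) * ⟪e k, Z⟫ := by
    rw [LinearMap.flip_apply, ← sum_apply_mul_inner e (B (e k)) W, Finset.sum_mul]
    exact Finset.sum_congr rfl fun l _ => by ring
  simp_rw [h]
  exact sum_apply_mul_inner e (B.flip W) Z

lemma sum_apply_mul_kulk_gF (e : OrthonormalBasis (Fin n) ℝ V) (B : V →ₗ[ℝ] V →ₗ[ℝ] ℝ)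
    (hB : ∀ X Y, B Y X = -B X Y) (Z W : V) :
    ∑ k, ∑ l, B (e k) (e l) * kulk gF gF (e k) (e l) Z W = 4 * B Z W := by
  have h (k l : Fin n) : B (e k) (e l) * kulk gF gF (e k) (e l) Z W =
      2 * (B (e k) (e l) * (⟪e k, Z⟫ * ⟪e l, W⟫)) -
        2 * (B (e k) (e l) * (⟪e k, W⟫ * ⟪e l, Z⟫)) := by
    rw [kulk_gF]
    ring
  simp_rw [h, Finset.sum_sub_distrib, ← Finset.mul_sum, sum_apply_mul_inner_mul_inner,
    hB Z W]
  ring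

variable {Q : V →ₗ[ℝ] V →ₗ[ℝ] V →ₗ[ℝ] V →ₗ[ℝ] ℝ}

lemma hatComp_qPlus_kulk_gF (hJ2 : ∀ X : V, J (J X) = -X)
    (hJO : ∀ X Y : V, ⟪J X, J Y⟫ = ⟪X, Y⟫) (hQ : CurvType (fun X Y Z W => Q X Y Z W))
    (X Y Z W : V) :
    hatComp e (qPlus J (kulk gF gF)) (fun X Y Z W => Q X Y Z W) X Y Z W =
      Q X Y Z W + Q X Y (J Z) (J W) := by
  have h (k l : Fin n) : Q X Y (e k) (e l) * qPlus J (kulk gF gF) (e k) (e l) Z W =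
      (1 / 2) * (Q X Y (e k) (e l) * kulk gF gF (e k) (e l) Z W) +
        (1 / 2) * (Q X Y (e k) (e l) * kulk gF gF (e k) (e l) (J Z) (J W)) := by
    rw [qPlus, kulk_gF_map_left hJ2 hJO, kulk_gF_map hJO]
    ring
  simp_rw [hatComp, h, Finset.sum_add_distrib, ← Finset.mul_sum,
    sum_apply_mul_kulk_gF e (Q X Y) (hQ.2.1 X Y)]
  ring

lemma hatComp_qMinus_kulk_gF (hJ2 : ∀ X : V, J (J X) = -X)
    (hJO : ∀ X Y : V, ⟪J X, J Y⟫ = ⟪X, Y⟫) (hQ : CurvType (fun X Y Z W => Q X Y Z W))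
    (X Y Z W : V) :
    hatComp e (qMinus J (kulk gF gF)) (fun X Y Z W => Q X Y Z W) X Y Z W =
      Q X Y Z W - Q X Y (J Z) (J W) := by
  have h (k l : Fin n) : Q X Y (e k) (e l) * qMinus J (kulk gF gF) (e k) (e l) Z W =
      (1 / 2) * (Q X Y (e k) (e l) * kulk gF gF (e k) (e l) Z W) -
        (1 / 2) * (Q X Y (e k) (e l) * kulk gF gF (e k) (e l) (J Z) (J W)) := by
    rw [qMinus, kulk_gF_map_left hJ2 hJO, kulk_gF_map hJO]
    ring
  simp_rw [hatComp, h, Finset.sum_sub_distrib, ← Finset.mul_sum,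
    sum_apply_mul_kulk_gF e (Q X Y) (hQ.2.1 X Y)]
  ring

/-- The trace of a 4-linear form is invariant under an orthogonal complex structure. -/
lemma sum_sum_apply_map (e : OrthonormalBasis (Fin n) ℝ V) (hJ2 : ∀ X : V, J (J X) = -X)
    (hJO : ∀ X Y : V, ⟪J X, J Y⟫ = ⟪X, Y⟫) (Q : V →ₗ[ℝ] V →ₗ[ℝ] V →ₗ[ℝ] V →ₗ[ℝ] ℝ) :
    ∑ i, ∑ j, Q (J (e i)) (J (e j)) (J (e i)) (J (e j)) =
      ∑ i, ∑ j, Q (e i) (e j) (e i) (e j) := by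
  have hj (X : V) : ∑ j, Q X (J (e j)) X (J (e j)) = ∑ j, Q X (e j) X (e j) :=
    sum_apply_map_map e hJ2 hJO ((Q X).flip X)
  have hi (Y : V) : ∑ i, Q (J (e i)) Y (J (e i)) Y = ∑ i, Q (e i) Y (e i) Y :=
    sum_apply_map_map e hJ2 hJO ((Q.flip Y).compr₂ (LinearMap.applyₗ Y))
  simp_rw [hj]
  rw [Finset.sum_comm]
  simp_rw [hi]
  exact Finset.sum_comm

end Helpers

theorem stmt3 [NormedAddCommGroup V] [InnerProductSpace ℝ V]
    {d : ℕ} (hd : 1 ≤ d) (e : OrthonormalBasis (Fin (2*d)) ℝ V)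
    (J : V →ₗ[ℝ] V) (hJ2 : ∀ X : V, J (J X) = -X)
    (hJO : ∀ X Y : V, ⟪J X, J Y⟫ = ⟪X, Y⟫)
    (Q : V →ₗ[ℝ] V →ₗ[ℝ] V →ₗ[ℝ] V →ₗ[ℝ] ℝ)
    (hQ : CurvType (fun X Y Z W => Q X Y Z W)) :
    formInner e (qPlus J (kulk gF gF)) (fun X Y Z W => Q X Y Z W)
      = trHat e (qPlus J (fun X Y Z W => Q X Y Z W)) ∧
    formInner e (qMinus J (kulk gF gF)) (fun X Y Z W => Q X Y Z W)
      = trHat e (qMinus J (fun X Y Z W => Q X Y Z W)) := by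
  have hswap (X Y : V) : Q (J X) (J Y) X Y = Q X Y (J X) (J Y) := hQ.2.2 X Y (J X) (J Y)
  have htr := sum_sum_apply_map e hJ2 hJO Q
  constructor
  · simp_rw [formInner, trHat, hatComp_qPlus_kulk_gF hJ2 hJO hQ, qPlus, hswap,
      ← Finset.mul_sum, Finset.sum_add_distrib, htr]
    ring
  · simp_rw [formInner, trHat, hatComp_qMinus_kulk_gF hJ2 hJO hQ, qMinus, hswap,
      ← Finset.mul_sum, Finset.sum_add_distrib, Finset.sum_sub_distrib, htr]
    ring

end Stmt
end
end

section
/- For every curvature-type 4-linear form Q on V satisfying the first Bianchi identity b(Q) = 0, one has ⟨ω⊙ω, Q⟩ = tr (Q^+)̂ − tr (Q^−)̂. -/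
noncomputable section
open Finset RealInnerProductSpace

namespace Stmt

variable {V : Type*}

variable [NormedAddCommGroup V] [InnerProductSpace ℝ V]

section

variable {W : Type*} [NormedAddCommGroup W] [InnerProductSpace ℝ W]

theorem omF_swap (J : W →ₗ[ℝ] W) (hJ2 : ∀ X : W, J (J X) = -X)
    (hJO : ∀ X Y : W, ⟪J X, J Y⟫ = ⟪X, Y⟫) (X Y : W) : omF J Y X = -omF J X Y := by
  have h := hJO (J Y) X
  rw [hJ2, inner_neg_left, real_inner_comm] at h
  simp only [omF]
  linarith

theorem sum_omF_mul {n : ℕ} (e : OrthonormalBasis (Fin n) ℝ W) (J : W →ₗ[ℝ] W)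
    (f : W →ₗ[ℝ] ℝ) (X : W) : ∑ j, f (e j) * omF J X (e j) = f (J X) := by
  conv_rhs => rw [← e.sum_repr' (J X)]
  simp only [map_sum, map_smul, smul_eq_mul, omF]
  exact sum_congr rfl fun j _ => by rw [mul_comm, real_inner_comm]

theorem sum_apply_J_left {n : ℕ} (e : OrthonormalBasis (Fin n) ℝ W) (J : W →ₗ[ℝ] W)
    (hJ2 : ∀ X : W, J (J X) = -X) (hJO : ∀ X Y : W, ⟪J X, J Y⟫ = ⟪X, Y⟫)
    (B : W →ₗ[ℝ] W →ₗ[ℝ] ℝ) : ∑ i, B (J (e i)) (e i) = -∑ i, B (e i) (J (e i)) := by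
  have hl (i : Fin n) : B (J (e i)) (e i) = ∑ j, B (e j) (e i) * omF J (e i) (e j) :=
    (sum_omF_mul e J (B.flip (e i)) (e i)).symm
  simp only [hl, ← sum_omF_mul e J (B _)]
  rw [sum_comm, ← sum_neg_distrib]
  refine sum_congr rfl fun i _ => ?_
  rw [← sum_neg_distrib]
  refine sum_congr rfl fun j _ => ?_
  rw [omF_swap J hJ2 hJO (e i) (e j), mul_neg]

/-- The Bianchi identity turns the double contraction of `Q` with `ω` into a trace. -/
theorem sum_contract_J_eq {n : ℕ} (e : OrthonormalBasis (Fin n) ℝ W) (J : W →ₗ[ℝ] W)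
    (hJ2 : ∀ X : W, J (J X) = -X) (hJO : ∀ X Y : W, ⟪J X, J Y⟫ = ⟪X, Y⟫)
    (Q : W →ₗ[ℝ] W →ₗ[ℝ] W →ₗ[ℝ] W →ₗ[ℝ] ℝ)
    (hQ : CurvType (fun X Y Z W => Q X Y Z W))
    (hb : ∀ X Y Z W : W, bianchi (fun a b c x => Q a b c x) X Y Z W = 0) :
    ∑ i, ∑ k, Q (e i) (J (e i)) (e k) (J (e k))
      = 2 * ∑ i, ∑ k, Q (e i) (e k) (J (e i)) (J (e k)) := by
  obtain ⟨h1, h2, -⟩ := hQ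
  have hsum (k : Fin n) : ∑ i, Q (J (e i)) (e k) (e i) (J (e k))
      = -∑ i, Q (e i) (e k) (J (e i)) (J (e k)) :=
    sum_apply_J_left e J hJ2 hJO
      ((Q.flip (e k)).compr₂ (LinearMap.applyₗ (J (e k))))
  have hpt (i k : Fin n) : Q (e i) (J (e i)) (e k) (J (e k))
      = Q (e i) (e k) (J (e i)) (J (e k)) - Q (J (e i)) (e k) (e i) (J (e k)) := by
    have := hb (e i) (J (e i)) (e k) (J (e k))
    have := h1 (e i) (e k) (J (e i)) (J (e k))
    simp only [bianchi] at *
    linarith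
  simp only [hpt, sum_sub_distrib]
  rw [sum_comm (f := fun i k => Q (J (e i)) (e k) (e i) (J (e k)))]
  simp only [hsum, sum_neg_distrib]
  rw [sum_comm (f := fun k i => Q (e i) (e k) (J (e i)) (J (e k)))]
  ring

theorem formInner_symProd_omF {n : ℕ} (e : OrthonormalBasis (Fin n) ℝ W) (J : W →ₗ[ℝ] W)
    (Q : W →ₗ[ℝ] W →ₗ[ℝ] W →ₗ[ℝ] W →ₗ[ℝ] ℝ) :
    formInner e (symProd (omF J) (omF J)) (fun X Y Z W => Q X Y Z W)
      = (1/4) * ∑ i, ∑ k, Q (e i) (J (e i)) (e k) (J (e k)) := by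
  have hkl (X Y : W) : ∑ k, ∑ l, Q X Y (e k) (e l) * symProd (omF J) (omF J) (e k) (e l) X Y
      = 2 * ((∑ k, Q X Y (e k) (J (e k))) * omF J X Y) := by
    simp only [← sum_omF_mul e J (Q X Y _), sum_mul, mul_sum, symProd]
    exact sum_congr rfl fun k _ => sum_congr rfl fun l _ => by ring
  have hij (i : Fin n) : ∑ j, (∑ k, Q (e i) (e j) (e k) (J (e k))) * omF J (e i) (e j)
      = ∑ k, Q (e i) (J (e i)) (e k) (J (e k)) := by
    simp only [sum_mul]
    rw [sum_comm]
    exact sum_congr rfl fun k _ =>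
      sum_omF_mul e J (((Q (e i)).flip (e k)).flip (J (e k))) (e i)
  simp only [formInner, trHat, hatComp, hkl, ← mul_sum, hij]
  ring

theorem trHat_qPlus_sub_trHat_qMinus {n : ℕ} (e : OrthonormalBasis (Fin n) ℝ W)
    (J : W →ₗ[ℝ] W) (Q : W → W → W → W → ℝ) (hQ : CurvType Q) :
    trHat e (qPlus J Q) - trHat e (qMinus J Q)
      = (1/2) * ∑ i, ∑ k, Q (e i) (e k) (J (e i)) (J (e k)) := by
  rw [trHat, trHat, ← mul_sub, ← sum_sub_distrib]
  congr 1
  refine sum_congr rfl fun i _ => ?_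
  rw [← sum_sub_distrib]
  refine sum_congr rfl fun k _ => ?_
  have := hQ.2.2 (e i) (e k) (J (e i)) (J (e k))
  simp only [qPlus, qMinus]
  linarith

end

theorem stmt4 [NormedAddCommGroup V] [InnerProductSpace ℝ V]
    {d : ℕ} (hd : 1 ≤ d) (e : OrthonormalBasis (Fin (2*d)) ℝ V)
    (J : V →ₗ[ℝ] V) (hJ2 : ∀ X : V, J (J X) = -X)
    (hJO : ∀ X Y : V, ⟪J X, J Y⟫ = ⟪X, Y⟫)
    (Q : V →ₗ[ℝ] V →ₗ[ℝ] V →ₗ[ℝ] V →ₗ[ℝ] ℝ)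
    (hQ : CurvType (fun X Y Z W => Q X Y Z W))
    (hb : ∀ X Y Z W : V, bianchi (fun a b c x => Q a b c x) X Y Z W = 0) :
    formInner e (symProd (omF J) (omF J)) (fun X Y Z W => Q X Y Z W)
      = trHat e (qPlus J (fun X Y Z W => Q X Y Z W))
        - trHat e (qMinus J (fun X Y Z W => Q X Y Z W)) := by
  rw [formInner_symProd_omF, trHat_qPlus_sub_trHat_qMinus e J _ hQ,
    sum_contract_J_eq e J hJ2 hJO Q hQ hb]
  ring

end Stmt
end
end

section
/- For every symmetric bilinear map s : V×V → E into a real vector space E, one has (g⊠g)∘s = 2(s − g·(tr s)) and (ω⊠ω)∘s = (ω⊙ω)∘s = −2(s^+ − s^−), where g·(tr s) denotes the map (X,Y) ↦ ⟨X,Y⟩·tr s. -/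
noncomputable section
open Finset RealInnerProductSpace

namespace Stmt

variable {V : Type*}

variable [NormedAddCommGroup V] [InnerProductSpace ℝ V]

/-- `(Q∘s)(X,Y) = Σ_{i,j} Q(e_i,X,Y,e_j)·s(e_i,e_j)` for an `E`-valued symmetric
bilinear map `s`. -/
def qCirc {n : ℕ} {E : Type*} [AddCommGroup E] [Module ℝ E]
    (e : OrthonormalBasis (Fin n) ℝ V) (Q : V → V → V → V → ℝ)
    (s : V → V → E) : V → V → E :=
  fun X Y => ∑ i, ∑ j, Q (e i) X Y (e j) • s (e i) (e j)

/-- Contraction of a bilinear map with two coordinate functionals. -/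
theorem sum_inner_mul_inner_smul {n : ℕ} {E : Type*} [AddCommGroup E] [Module ℝ E]
    (e : OrthonormalBasis (Fin n) ℝ V) (s : V →ₗ[ℝ] V →ₗ[ℝ] E) (a b : V) :
    ∑ i, ∑ j, (⟪e i, a⟫ * ⟪e j, b⟫) • s (e i) (e j) = s a b := by
  conv_rhs => rw [← e.sum_repr' a, ← e.sum_repr' b]
  simp only [map_sum, map_smul, LinearMap.sum_apply, LinearMap.smul_apply, Finset.smul_sum,
    smul_smul]
  rw [Finset.sum_comm]
  simp only [mul_comm]

/-- The full contraction of an antisymmetric form with a symmetric map vanishes. -/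
theorem sum_antisymm_smul_symm {ι E : Type*} [Fintype ι] [AddCommGroup E] [Module ℝ E]
    (a : ι → ι → ℝ) (ha : ∀ i j, a j i = -a i j) (s : ι → ι → E) (hs : ∀ i j, s i j = s j i) :
    ∑ i, ∑ j, a i j • s i j = 0 := by
  have h : ∑ i, ∑ j, a i j • s i j = -∑ i, ∑ j, a i j • s i j := by
    conv_lhs => rw [Finset.sum_comm]
    simp only [← Finset.sum_neg_distrib]
    refine Finset.sum_congr rfl fun i _ => Finset.sum_congr rfl fun j _ => ?_
    rw [ha, hs, neg_smul]
  have : IsAddTorsionFree E := .of_isTorsionFree ℝ E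
  exact self_eq_neg.mp h

theorem inner_map_left_eq_neg (J : V →ₗ[ℝ] V) (hJ2 : ∀ X : V, J (J X) = -X)
    (hJO : ∀ X Y : V, ⟪J X, J Y⟫ = ⟪X, Y⟫) (X Y : V) : ⟪J X, Y⟫ = -⟪X, J Y⟫ := by
  rw [← hJO X (J Y), hJ2, inner_neg_right, neg_neg]

theorem qCirc_kulk_gF {n : ℕ} {E : Type*} [AddCommGroup E] [Module ℝ E]
    (e : OrthonormalBasis (Fin n) ℝ V) (s : V →ₗ[ℝ] V →ₗ[ℝ] E)
    (hs : ∀ X Y : V, s X Y = s Y X) (X Y : V) :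
    qCirc e (kulk gF gF) (fun a b => s a b) X Y
      = (2:ℝ) • (s X Y - ⟪X, Y⟫ • (∑ i, s (e i) (e i))) := by
  have htr : ∑ i, ∑ j, ⟪e i, e j⟫ • s (e i) (e j) = ∑ i, s (e i) (e i) := by
    simp [e.inner_eq_ite, ite_smul]
  rw [hs X Y, ← sum_inner_mul_inner_smul e s Y X, ← htr]
  simp only [qCirc, Finset.smul_sum, ← Finset.sum_sub_distrib]
  refine Finset.sum_congr rfl fun i _ => Finset.sum_congr rfl fun j _ => ?_
  simp only [kulk, symProd, gF, real_inner_comm X (e j)]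
  module

theorem qCirc_symProd_omF {n : ℕ} {E : Type*} [AddCommGroup E] [Module ℝ E]
    (e : OrthonormalBasis (Fin n) ℝ V) (J : V →ₗ[ℝ] V) (hJ2 : ∀ X : V, J (J X) = -X)
    (hJO : ∀ X Y : V, ⟪J X, J Y⟫ = ⟪X, Y⟫) (s : V →ₗ[ℝ] V →ₗ[ℝ] E) (X Y : V) :
    qCirc e (symProd (omF J) (omF J)) (fun a b => s a b) X Y = (-2:ℝ) • s (J X) (J Y) := by
  rw [← sum_inner_mul_inner_smul e s (J X) (J Y)]
  simp only [qCirc, Finset.smul_sum]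
  refine Finset.sum_congr rfl fun i _ => Finset.sum_congr rfl fun j _ => ?_
  simp only [symProd, omF, inner_map_left_eq_neg J hJ2 hJO (e i), real_inner_comm (J Y) (e j)]
  module

theorem qCirc_kulk_omF {n : ℕ} {E : Type*} [AddCommGroup E] [Module ℝ E]
    (e : OrthonormalBasis (Fin n) ℝ V) (J : V →ₗ[ℝ] V) (hJ2 : ∀ X : V, J (J X) = -X)
    (hJO : ∀ X Y : V, ⟪J X, J Y⟫ = ⟪X, Y⟫) (s : V →ₗ[ℝ] V →ₗ[ℝ] E)
    (hs : ∀ X Y : V, s X Y = s Y X) (X Y : V) :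
    qCirc e (kulk (omF J) (omF J)) (fun a b => s a b) X Y = (-2:ℝ) • s (J X) (J Y) := by
  have hω : ∑ i, ∑ j, ⟪J (e i), e j⟫ • s (e i) (e j) = 0 :=
    sum_antisymm_smul_symm _
      (fun i j => by rw [inner_map_left_eq_neg J hJ2 hJO, real_inner_comm])
      _ (fun i j => hs (e i) (e j))
  have hsplit : qCirc e (kulk (omF J) (omF J)) (fun a b => s a b) X Y
      = qCirc e (symProd (omF J) (omF J)) (fun a b => s a b) Y X
        - (2 * ⟪J X, Y⟫) • ∑ i, ∑ j, ⟪J (e i), e j⟫ • s (e i) (e j) := by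
    simp only [qCirc, Finset.smul_sum, ← Finset.sum_sub_distrib]
    refine Finset.sum_congr rfl fun i _ => Finset.sum_congr rfl fun j _ => ?_
    simp only [kulk, symProd, omF]
    module
  rw [hsplit, hω, smul_zero, sub_zero, qCirc_symProd_omF e J hJ2 hJO, hs]

theorem stmt6 [NormedAddCommGroup V] [InnerProductSpace ℝ V]
    {d : ℕ} (hd : 1 ≤ d) (e : OrthonormalBasis (Fin (2*d)) ℝ V)
    (J : V →ₗ[ℝ] V) (hJ2 : ∀ X : V, J (J X) = -X)
    (hJO : ∀ X Y : V, ⟪J X, J Y⟫ = ⟪X, Y⟫)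
    {E : Type*} [AddCommGroup E] [Module ℝ E]
    (s : V →ₗ[ℝ] V →ₗ[ℝ] E) (hs : ∀ X Y : V, s X Y = s Y X) :
    (∀ X Y : V,
      qCirc e (kulk gF gF) (fun a b => s a b) X Y
        = (2:ℝ) • (s X Y - ⟪X, Y⟫ • (∑ i, s (e i) (e i)))) ∧
    (∀ X Y : V,
      qCirc e (kulk (omF J) (omF J)) (fun a b => s a b) X Y
        = qCirc e (symProd (omF J) (omF J)) (fun a b => s a b) X Y) ∧
    (∀ X Y : V,
      qCirc e (kulk (omF J) (omF J)) (fun a b => s a b) X Y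
        = (-2:ℝ) • ((1/2:ℝ) • (s X Y + s (J X) (J Y))
            - (1/2:ℝ) • (s X Y - s (J X) (J Y)))) := by
  have hkulk := qCirc_kulk_omF e J hJ2 hJO s hs
  refine ⟨qCirc_kulk_gF e s hs, fun X Y => ?_, fun X Y => ?_⟩
  · rw [hkulk, qCirc_symProd_omF e J hJ2 hJO]
  · rw [hkulk]
    module

end Stmt
end
end

section
/- For every symmetric bilinear map s : V×V → E into a real vector space E, one has (A⊠A)∘s = 2(τ*s − (Σ_{i,j} A(e_i,e_j)·s(e_i,e_j))·A) and (B⊠B)∘s = 2((Jτ)*s − (Σ_{i,j} B(e_i,e_j)·s(e_i,e_j))·B), where (τ*s)(X,Y) = s(τX,τY) and ((Jτ)*s)(X,Y) = s(JτX,JτY). -/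
noncomputable section
open Finset RealInnerProductSpace

namespace Stmt

variable {V : Type*}

variable [NormedAddCommGroup V] [InnerProductSpace ℝ V]

theorem sum_inner_smul_map {n : ℕ} (e : OrthonormalBasis (Fin n) ℝ V)
    {E : Type*} [AddCommGroup E] [Module ℝ E] (f : V →ₗ[ℝ] E) (Z : V) :
    ∑ i, ⟪Z, e i⟫ • f (e i) = f Z := by
  conv_rhs => rw [← e.sum_repr' Z, map_sum]
  simp only [map_smul, real_inner_comm]

/-- Contraction of `h⊠h` with a symmetric bilinear map, for `h(X,Y) = ⟨σX,Y⟩` with `σ`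
symmetric. -/
theorem qCirc_kulk_self {n : ℕ} (e : OrthonormalBasis (Fin n) ℝ V)
    (σ : V →ₗ[ℝ] V) (hσ : ∀ X Y : V, ⟪σ X, Y⟫ = ⟪X, σ Y⟫)
    {E : Type*} [AddCommGroup E] [Module ℝ E]
    (s : V →ₗ[ℝ] V →ₗ[ℝ] E) (hs : ∀ X Y : V, s X Y = s Y X) (X Y : V) :
    qCirc e (kulk (aF σ) (aF σ)) (fun a b => s a b) X Y
      = (2:ℝ) • (s (σ X) (σ Y)
          - aF σ X Y • (∑ i, ∑ j, aF σ (e i) (e j) • s (e i) (e j))) := by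
  have key : ∑ i, ∑ j, (⟪σ Y, e i⟫ * ⟪σ X, e j⟫) • s (e i) (e j) = s (σ X) (σ Y) := by
    simp only [mul_smul, ← Finset.smul_sum, sum_inner_smul_map]
    rw [hs (σ X)]
    exact sum_inner_smul_map e (s.flip (σ X)) (σ Y)
  rw [← key]
  simp only [qCirc, kulk, symProd, aF, Finset.smul_sum, smul_smul,
    ← Finset.sum_sub_distrib, ← sub_smul]
  refine Finset.sum_congr rfl fun i _ => Finset.sum_congr rfl fun j _ => ?_
  rw [hσ (e i) Y, real_inner_comm (σ Y) (e i)]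
  congr 1
  ring

theorem stmt9 [NormedAddCommGroup V] [InnerProductSpace ℝ V]
    {d : ℕ} (hd : 1 ≤ d) (e : OrthonormalBasis (Fin (2*d)) ℝ V)
    (J : V →ₗ[ℝ] V) (hJ2 : ∀ X : V, J (J X) = -X)
    (hJO : ∀ X Y : V, ⟪J X, J Y⟫ = ⟪X, Y⟫)
    (τ : V →ₗ[ℝ] V) (hτs : ∀ X Y : V, ⟪τ X, Y⟫ = ⟪X, τ Y⟫)
    (hτJ : ∀ X : V, τ (J X) = - J (τ X))
    {E : Type*} [AddCommGroup E] [Module ℝ E]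
    (s : V →ₗ[ℝ] V →ₗ[ℝ] E) (hs : ∀ X Y : V, s X Y = s Y X) :
    (∀ X Y : V,
      qCirc e (kulk (aF τ) (aF τ)) (fun a b => s a b) X Y
        = (2:ℝ) • (s (τ X) (τ Y)
            - aF τ X Y • (∑ i, ∑ j, aF τ (e i) (e j) • s (e i) (e j)))) ∧
    (∀ X Y : V,
      qCirc e (kulk (bF J τ) (bF J τ)) (fun a b => s a b) X Y
        = (2:ℝ) • (s (J (τ X)) (J (τ Y))
            - bF J τ X Y • (∑ i, ∑ j, bF J τ (e i) (e j) • s (e i) (e j)))) := by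
  refine ⟨qCirc_kulk_self e τ hτs s hs, qCirc_kulk_self e (J ∘ₗ τ) (fun X Y => ?_) s hs⟩
  rw [LinearMap.comp_apply, LinearMap.comp_apply, ← hJO, hJ2, inner_neg_left, hτs, hτJ,
    inner_neg_right, neg_neg]

end Stmt
end
end

section
/- Assume in addition that τ² = (|τ|²/(2d))·id, where |τ|² = Σ_i ⟨τe_i,τe_i⟩. Then c(A⊠A) = c(B⊠B) = −(|τ|²/d)·g and tr (A⊠A)̂ = tr (B⊠B)̂ = −|τ|². -/
noncomputable section
open Finset RealInnerProductSpace

namespace Stmt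

variable {V : Type*}

variable [NormedAddCommGroup V] [InnerProductSpace ℝ V]

/-- An endomorphism that anticommutes with a complex structure is trace-free. -/
theorem trace_eq_zero_of_anticomm
    (J σ : V →ₗ[ℝ] V) (hJ2 : ∀ X : V, J (J X) = -X) (hσJ : ∀ X : V, σ (J X) = - J (σ X)) :
    LinearMap.trace ℝ V σ = 0 := by
  have h₁ : J * (σ * J) = σ := by
    ext X
    simp [hσJ, hJ2]
  have h₂ : (σ * J) * J = -σ := by
    ext X
    simp [hJ2]
  have h := LinearMap.trace_mul_comm ℝ J (σ * J)
  rw [h₁, h₂, map_neg] at h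
  linarith

/-- The Ricci contraction of `h⊠h`, where `h(X,Y) = ⟨σX,Y⟩` for a symmetric trace-free `σ`. -/
theorem ricciC_kulk_self
    {n : ℕ} (e : OrthonormalBasis (Fin n) ℝ V) (σ : V →ₗ[ℝ] V)
    (hσ : ∀ X Y : V, ⟪σ X, Y⟫ = ⟪X, σ Y⟫) (htr : LinearMap.trace ℝ V σ = 0) (X Y : V) :
    ricciC e (kulk (aF σ) (aF σ)) X Y = -2 * ⟪σ (σ X), Y⟫ := by
  have htr' : ∑ i, ⟪σ (e i), e i⟫ = 0 := by
    rw [← htr, LinearMap.trace_eq_sum_inner σ e]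
    exact Finset.sum_congr rfl fun i _ => real_inner_comm _ _
  have hXY : ∑ i, ⟪σ X, e i⟫ * ⟪σ (e i), Y⟫ = ⟪σ (σ X), Y⟫ := by
    simp only [hσ _ Y]
    exact e.sum_inner_mul_inner (σ X) (σ Y)
  calc ricciC e (kulk (aF σ) (aF σ)) X Y
      = ∑ i, (2 * ⟪σ X, Y⟫ * ⟪σ (e i), e i⟫ - 2 * (⟪σ X, e i⟫ * ⟪σ (e i), Y⟫)) :=
        Finset.sum_congr rfl fun i _ => by
          simp only [kulk, symProd, aF]
          ring
    _ = -2 * ⟪σ (σ X), Y⟫ := by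
        rw [Finset.sum_sub_distrib, ← Finset.mul_sum, ← Finset.mul_sum, htr', hXY]
        ring

/-- The trace of `Q̂` is half the trace of the Ricci contraction of `Q`. -/
theorem trHat_eq_sum_ricciC
    {n : ℕ} (e : OrthonormalBasis (Fin n) ℝ V) (Q : V → V → V → V → ℝ) :
    trHat e Q = (1/2) * ∑ j, ricciC e Q (e j) (e j) := by
  simp only [trHat, ricciC]
  rw [Finset.sum_comm]

/-- The trace of `Q̂` when the Ricci contraction of `Q` is a multiple of the metric. -/
theorem trHat_of_ricciC_eq
    {n : ℕ} (e : OrthonormalBasis (Fin n) ℝ V) (Q : V → V → V → V → ℝ) (c : ℝ)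
    (hQ : ∀ X Y : V, ricciC e Q X Y = c * ⟪X, Y⟫) :
    trHat e Q = n * c / 2 := by
  rw [trHat_eq_sum_ricciC]
  simp [hQ]
  ring

theorem stmt10 [NormedAddCommGroup V] [InnerProductSpace ℝ V]
    {d : ℕ} (hd : 1 ≤ d) (e : OrthonormalBasis (Fin (2*d)) ℝ V)
    (J : V →ₗ[ℝ] V) (hJ2 : ∀ X : V, J (J X) = -X)
    (hJO : ∀ X Y : V, ⟪J X, J Y⟫ = ⟪X, Y⟫)
    (τ : V →ₗ[ℝ] V) (hτs : ∀ X Y : V, ⟪τ X, Y⟫ = ⟪X, τ Y⟫)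
    (hτJ : ∀ X : V, τ (J X) = - J (τ X))
    (hτ2 : ∀ X : V,
      τ (τ X) = ((∑ i, ⟪τ (e i), τ (e i)⟫) / (2*(d:ℝ))) • X) :
    (∀ X Y : V, ricciC e (kulk (aF τ) (aF τ)) X Y
      = -((∑ i, ⟪τ (e i), τ (e i)⟫) / (d:ℝ)) * ⟪X, Y⟫) ∧
    (∀ X Y : V, ricciC e (kulk (bF J τ) (bF J τ)) X Y
      = -((∑ i, ⟪τ (e i), τ (e i)⟫) / (d:ℝ)) * ⟪X, Y⟫) ∧
    trHat e (kulk (aF τ) (aF τ)) = -(∑ i, ⟪τ (e i), τ (e i)⟫) ∧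
    trHat e (kulk (bF J τ) (bF J τ)) = -(∑ i, ⟪τ (e i), τ (e i)⟫) := by
  have hB : bF J τ = aF (J * τ) := rfl
  have hJs : ∀ X Y : V, ⟪J X, Y⟫ = -⟪X, J Y⟫ := fun X Y => by
    rw [← hJO X (J Y), hJ2, inner_neg_right, neg_neg]
  have hBs : ∀ X Y : V, ⟪(J * τ) X, Y⟫ = ⟪X, (J * τ) Y⟫ := fun X Y => by
    simp [hJs, hτs, hτJ]
  have hBJ : ∀ X : V, (J * τ) (J X) = - J ((J * τ) X) := fun X => by
    simp [hτJ]
  have hB2 : ∀ X : V, (J * τ) ((J * τ) X) = τ (τ X) := fun X => by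
    simp [hτJ, hJ2]
  have hd0 : (d : ℝ) ≠ 0 := Nat.cast_ne_zero.mpr (by omega)
  have hcA : ∀ X Y : V, ricciC e (kulk (aF τ) (aF τ)) X Y
      = -((∑ i, ⟪τ (e i), τ (e i)⟫) / (d:ℝ)) * ⟪X, Y⟫ := fun X Y => by
    rw [ricciC_kulk_self e τ hτs (trace_eq_zero_of_anticomm J τ hJ2 hτJ), hτ2,
      real_inner_smul_left]
    field_simp
  have hcB : ∀ X Y : V, ricciC e (kulk (bF J τ) (bF J τ)) X Y
      = -((∑ i, ⟪τ (e i), τ (e i)⟫) / (d:ℝ)) * ⟪X, Y⟫ := fun X Y => by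
    rw [hB, ricciC_kulk_self e _ hBs (trace_eq_zero_of_anticomm J _ hJ2 hBJ), hB2, hτ2,
      real_inner_smul_left]
    field_simp
  refine ⟨hcA, hcB, ?_, ?_⟩
  · rw [trHat_of_ricciC_eq e _ _ hcA]
    push_cast
    field_simp
  · rw [trHat_of_ricciC_eq e _ _ hcB]
    push_cast
    field_simp

end Stmt
end
end

section
/- Let T be a curvature-type 4-linear form on V with b(T) = 0 and let T^ℂ denote its complex-multilinear extension to V⊗ℂ. For X,Y ∈ V set Z = (X − i·JX)/√2 and W = (Y − i·JY)/√2, and let Z̄, W̄ be their complex conjugates. Then T^ℂ(Z,W,Z̄,W̄) = T^−(X,Y,X,Y) + T^−(X,JY,X,JY) and T^ℂ(Z,W̄,Z̄,W) = T^+(X,Y,X,Y) + T^+(X,JY,X,JY). -/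
noncomputable section
open Finset RealInnerProductSpace

namespace Stmt

variable {V : Type*}

variable [NormedAddCommGroup V] [InnerProductSpace ℝ V]

/-- Evaluation of a map `f : V → ℂ` on a complexified vector `z = z.1 + i·z.2`. -/
def cx1 (f : V → ℂ) : V × V → ℂ := fun z => f z.1 + Complex.I * f z.2

/-- The complex-multilinear extension of a real 4-linear form to `V⊗ℂ`,
where an element `u + i·v` of `V⊗ℂ` is represented by the pair `(u,v) : V × V`. -/
def cext (T : V → V → V → V → ℝ) : V × V → V × V → V × V → V × V → ℂ :=
  fun z w u v =>
    cx1 (fun a => cx1 (fun b => cx1 (fun c => cx1 (fun x => ((T a b c x : ℝ) : ℂ)) v) u) w) z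

theorem stmt12 [NormedAddCommGroup V] [InnerProductSpace ℝ V]
    {d : ℕ} (hd : 1 ≤ d) (e : OrthonormalBasis (Fin (2*d)) ℝ V)
    (J : V →ₗ[ℝ] V) (hJ2 : ∀ X : V, J (J X) = -X)
    (hJO : ∀ X Y : V, ⟪J X, J Y⟫ = ⟪X, Y⟫)
    (T : V →ₗ[ℝ] V →ₗ[ℝ] V →ₗ[ℝ] V →ₗ[ℝ] ℝ)
    (hT : CurvType (fun a b c x => T a b c x))
    (hb : ∀ X Y Z W : V, bianchi (fun a b c x => T a b c x) X Y Z W = 0)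
    (X Y : V) :
    cext (fun a b c x => T a b c x)
        ((Real.sqrt 2)⁻¹ • X, -((Real.sqrt 2)⁻¹ • J X))
        ((Real.sqrt 2)⁻¹ • Y, -((Real.sqrt 2)⁻¹ • J Y))
        ((Real.sqrt 2)⁻¹ • X, (Real.sqrt 2)⁻¹ • J X)
        ((Real.sqrt 2)⁻¹ • Y, (Real.sqrt 2)⁻¹ • J Y)
      = ((qMinus J (fun a b c x => T a b c x) X Y X Y
          + qMinus J (fun a b c x => T a b c x) X (J Y) X (J Y) : ℝ) : ℂ) ∧
    cext (fun a b c x => T a b c x)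
        ((Real.sqrt 2)⁻¹ • X, -((Real.sqrt 2)⁻¹ • J X))
        ((Real.sqrt 2)⁻¹ • Y, (Real.sqrt 2)⁻¹ • J Y)
        ((Real.sqrt 2)⁻¹ • X, (Real.sqrt 2)⁻¹ • J X)
        ((Real.sqrt 2)⁻¹ • Y, -((Real.sqrt 2)⁻¹ • J Y))
      = ((qPlus J (fun a b c x => T a b c x) X Y X Y
          + qPlus J (fun a b c x => T a b c x) X (J Y) X (J Y) : ℝ) : ℂ) := by
  have hs : ∀ A B C D : V, T C D A B = T A B C D := hT.2.2
  have hc : (((Real.sqrt 2)⁻¹ : ℝ) : ℂ) ^ 4 = 1 / 4 := by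
    norm_cast
    rw [inv_pow, show (4 : ℕ) = 2 * 2 from rfl, pow_mul, Real.sq_sqrt (by norm_num)]
    norm_num
  have hneg : ∀ A B C D : V, T (-A) B C D = -T A B C D := fun A B C D => by
    rw [← neg_one_smul ℝ A, map_smul]
    simp only [LinearMap.smul_apply, smul_eq_mul, neg_one_mul]
  have hI : Complex.I ^ 2 = -1 := Complex.I_sq
  have hIfour : Complex.I ^ 4 = 1 := Complex.I_pow_four
  constructor <;>
  · simp only [cext, cx1, qMinus, qPlus, hJ2, map_smul, map_neg, hneg, LinearMap.smul_apply,
      LinearMap.neg_apply, smul_eq_mul]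
    simp only [hs X Y (J X) (J Y), hs X Y X (J Y), hs X Y (J X) Y,
      hs (J X) (J Y) X (J Y), hs (J X) (J Y) (J X) Y, hs X (J Y) (J X) Y]
    push_cast
    ring_nf
    simp only [hI, hIfour]
    ring_nf
    push_cast at hc
    simp only [inv_pow] at hc ⊢
    simp only [hc]
    ring

end Stmt
end
end

section
/- With τ a ⟨·,·⟩-symmetric linear map anticommuting with J, the associated endomorphisms of Λ²V satisfy (g⊠B)̂∘(ω⊠ω)̂ = 2·(ω⊠A)̂ and (g⊠B)̂∘(g⊠g)̂ = 2·(g⊠B)̂. -/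
noncomputable section
open Finset RealInnerProductSpace

namespace Stmt

variable {V : Type*}

variable [NormedAddCommGroup V] [InnerProductSpace ℝ V]

/-- The bilinear form with the same values as `γ` on the basis vectors of `e`. -/
def bilinExt {n : ℕ} (e : OrthonormalBasis (Fin n) ℝ V) (γ : V → V → ℝ) : V → V → ℝ :=
  fun X Y => ∑ i, ∑ j, γ (e i) (e j) * (⟪e i, X⟫ * ⟪e j, Y⟫)

section

variable {n : ℕ} (e : OrthonormalBasis (Fin n) ℝ V) (γ : V → V → ℝ)

theorem bilinExt_neg_left (X Y : V) : bilinExt e γ (-X) Y = -bilinExt e γ X Y := by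
  simp [bilinExt, inner_neg_right]

theorem bilinExt_neg_right (X Y : V) : bilinExt e γ X (-Y) = -bilinExt e γ X Y := by
  simp [bilinExt, inner_neg_right]

theorem bilinExt_swap (hγ : ∀ X Y : V, γ Y X = -γ X Y) (X Y : V) :
    bilinExt e γ Y X = -bilinExt e γ X Y := by
  unfold bilinExt
  rw [sum_comm]
  simp only [← sum_neg_distrib]
  refine sum_congr rfl fun i _ => sum_congr rfl fun j _ => ?_
  rw [hγ (e i) (e j)]
  ring

theorem bilinExt_const_mul (c : ℝ) (X Y : V) :
    bilinExt e (fun X Y => c * γ X Y) X Y = c * bilinExt e γ X Y := by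
  simp only [bilinExt, mul_sum, mul_assoc]

theorem sum_inner_map_mul_inner (S : V →ₗ[ℝ] V) (v X : V) :
    ∑ i, ⟪v, S (e i)⟫ * ⟪e i, X⟫ = ⟪v, S X⟫ := by
  conv_rhs => rw [← e.sum_repr' X]
  simp [inner_sum, inner_smul_right, mul_comm]

theorem bilinExt_bilinExt_comp (S T : V →ₗ[ℝ] V) (X Y : V) :
    bilinExt e (fun X Y => bilinExt e γ (S X) (T Y)) X Y = bilinExt e γ (S X) (T Y) := by
  calc bilinExt e (fun X Y => bilinExt e γ (S X) (T Y)) X Y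
      = ∑ i, ∑ j, ∑ k, ∑ l, γ (e k) (e l) *
          ((⟪e k, S (e i)⟫ * ⟪e i, X⟫) * (⟪e l, T (e j)⟫ * ⟪e j, Y⟫)) := by
        simp only [bilinExt, sum_mul]
        refine sum_congr rfl fun i _ => sum_congr rfl fun j _ => sum_congr rfl fun k _ =>
          sum_congr rfl fun l _ => ?_
        ring
    _ = ∑ k, ∑ l, ∑ i, ∑ j, γ (e k) (e l) *
          ((⟪e k, S (e i)⟫ * ⟪e i, X⟫) * (⟪e l, T (e j)⟫ * ⟪e j, Y⟫)) := by
        rw [sum_congr rfl fun i _ => sum_comm, sum_comm]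
        refine sum_congr rfl fun k _ => ?_
        rw [sum_congr rfl fun i _ => sum_comm, sum_comm]
    _ = bilinExt e γ (S X) (T Y) := by
        simp only [← mul_sum, ← sum_mul, sum_inner_map_mul_inner, bilinExt]

/-- The action of `h⊠k` on an antisymmetric form, in terms of the endomorphisms
representing `h` and `k`. -/
theorem hatOp_kulk (hγ : ∀ X Y : V, γ Y X = -γ X Y) {h k : V → V → ℝ} {S T : V → V}
    (hh : ∀ X Y, h X Y = ⟪X, S Y⟫) (hk : ∀ X Y, k X Y = ⟪X, T Y⟫) (X Y : V) :
    hatOp e (kulk h k) γ X Y = bilinExt e γ (S X) (T Y) + bilinExt e γ (T X) (S Y) := by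
  have expand : hatOp e (kulk h k) γ X Y = (1/2) *
      (bilinExt e γ (S X) (T Y) + bilinExt e γ (T X) (S Y)
        - bilinExt e γ (S Y) (T X) - bilinExt e γ (T Y) (S X)) := by
    simp only [hatOp, kulk, symProd, hh, hk, bilinExt, ← sum_add_distrib, ← sum_sub_distrib]
    congr 1
    refine sum_congr rfl fun i _ => sum_congr rfl fun j _ => ?_
    ring
  rw [expand, bilinExt_swap e γ hγ (T X) (S Y), bilinExt_swap e γ hγ (S X) (T Y)]
  ring

end

theorem stmt13 [NormedAddCommGroup V] [InnerProductSpace ℝ V]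
    {d : ℕ} (hd : 1 ≤ d) (e : OrthonormalBasis (Fin (2*d)) ℝ V)
    (J : V →ₗ[ℝ] V) (hJ2 : ∀ X : V, J (J X) = -X)
    (hJO : ∀ X Y : V, ⟪J X, J Y⟫ = ⟪X, Y⟫)
    (τ : V →ₗ[ℝ] V) (hτs : ∀ X Y : V, ⟪τ X, Y⟫ = ⟪X, τ Y⟫)
    (hτJ : ∀ X : V, τ (J X) = - J (τ X)) :
    ∀ γ : V → V → ℝ, (∀ X Y : V, γ Y X = - γ X Y) →
      (∀ X Y : V,
        hatOp e (kulk gF (bF J τ)) (hatOp e (kulk (omF J) (omF J)) γ) X Y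
          = 2 * hatOp e (kulk (omF J) (aF τ)) γ X Y) ∧
      (∀ X Y : V,
        hatOp e (kulk gF (bF J τ)) (hatOp e (kulk gF gF) γ) X Y
          = 2 * hatOp e (kulk gF (bF J τ)) γ X Y) := by
  intro γ hγ
  have hJ : ∀ X Y : V, ⟪J X, Y⟫ = ⟪X, -J Y⟫ := fun X Y => by
    rw [← hJO X (-J Y), map_neg, hJ2, neg_neg]
  have hg : ∀ X Y : V, gF X Y = ⟪X, (LinearMap.id : V →ₗ[ℝ] V) Y⟫ := fun _ _ => rfl
  have hω : ∀ X Y : V, omF J X Y = ⟪X, (-J) Y⟫ := hJ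
  have hA : ∀ X Y : V, aF τ X Y = ⟪X, τ Y⟫ := hτs
  have hB : ∀ X Y : V, bF J τ X Y = ⟪X, (J ∘ₗ τ) Y⟫ := fun X Y => by
    simp only [bF, LinearMap.comp_apply]
    rw [hJ, hτs, map_neg, hτJ, neg_neg]
  have key : ∀ S : V →ₗ[ℝ] V, ∀ h : V → V → ℝ, (∀ X Y, h X Y = ⟪X, S Y⟫) → ∀ X Y : V,
      hatOp e (kulk gF (bF J τ)) (hatOp e (kulk h h) γ) X Y
        = 2 * (bilinExt e γ (S X) (S (J (τ Y))) + bilinExt e γ (S (J (τ X))) (S Y)) := by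
    intro S h hS X Y
    have inner_eq : hatOp e (kulk h h) γ = fun X Y => 2 * bilinExt e γ (S X) (S Y) := by
      funext X Y
      rw [hatOp_kulk e γ hγ hS hS]
      ring
    have anti : ∀ X Y : V, 2 * bilinExt e γ (S Y) (S X) = -(2 * bilinExt e γ (S X) (S Y)) :=
      fun X Y => by rw [bilinExt_swap e γ hγ]; ring
    rw [inner_eq, hatOp_kulk e _ anti hg hB, bilinExt_const_mul e
      (fun X Y => bilinExt e γ (S X) (S Y)), bilinExt_const_mul e
      (fun X Y => bilinExt e γ (S X) (S Y)), bilinExt_bilinExt_comp, bilinExt_bilinExt_comp]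
    simp only [LinearMap.id_apply, LinearMap.comp_apply]
    ring
  refine ⟨fun X Y => ?_, fun X Y => ?_⟩
  · rw [key (-J) _ hω, hatOp_kulk e γ hγ hω hA]
    simp only [LinearMap.neg_apply, hJ2, neg_neg]
  · rw [key LinearMap.id _ hg, hatOp_kulk e γ hγ hg hB]
    rfl

end Stmt
end
end

section
/- Let P and Q be curvature-type 4-linear forms on V such that P(JX,JY,Z,W) = P(X,Y,Z,W) and Q(JX,JY,Z,W) = −Q(X,Y,Z,W) for all X,Y,Z,W. Then P̂∘Q̂ = 0 and Q̂∘P̂ = 0. Moreover, for every such Q one has ((g⊠g)^−)̂∘Q̂ = 2·Q̂. -/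
noncomputable section
open Finset RealInnerProductSpace

namespace Stmt

variable {V : Type*}

variable [NormedAddCommGroup V] [InnerProductSpace ℝ V]

section Contraction

variable {E : Type*} [NormedAddCommGroup E] [InnerProductSpace ℝ E] {n : ℕ}

lemma sum_inner_mul_apply (e : OrthonormalBasis (Fin n) ℝ E) (b : E →ₗ[ℝ] ℝ) (x : E) :
    ∑ i, ⟪e i, x⟫ * b (e i) = b x := by
  conv_rhs => rw [← e.sum_repr' x]
  simp [map_sum]

lemma sum_sum_inner_mul_apply (e : OrthonormalBasis (Fin n) ℝ E) (B : E →ₗ[ℝ] E →ₗ[ℝ] ℝ)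
    (x y : E) : ∑ i, ∑ j, (⟪e i, x⟫ * ⟪e j, y⟫) * B (e i) (e j) = B x y := by
  simp only [mul_assoc, ← mul_sum, sum_inner_mul_apply]
  exact sum_inner_mul_apply e (B.flip y) x

lemma inner_apply_right_eq_neg {J : E →ₗ[ℝ] E} (hJ2 : ∀ x, J (J x) = -x)
    (hJO : ∀ x y, ⟪J x, J y⟫ = ⟪x, y⟫) (x y : E) : ⟪x, J y⟫ = -⟪J x, y⟫ := by
  rw [← hJO x (J y), hJ2, inner_neg_right]

/-- An orthogonal complex structure is skew for the contraction of two linear forms. -/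
lemma sum_comp_mul_eq_neg (e : OrthonormalBasis (Fin n) ℝ E) {J : E →ₗ[ℝ] E}
    (hJ2 : ∀ x, J (J x) = -x) (hJO : ∀ x y, ⟪J x, J y⟫ = ⟪x, y⟫) (a b : E →ₗ[ℝ] ℝ) :
    ∑ i, a (J (e i)) * b (e i) = -∑ i, a (e i) * b (J (e i)) := by
  simp only [← sum_inner_mul_apply e a (J _), ← sum_inner_mul_apply e b (J _), sum_mul, mul_sum]
  rw [sum_comm, ← sum_neg_distrib]
  refine sum_congr rfl fun i _ => ?_
  rw [← sum_neg_distrib]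
  refine sum_congr rfl fun j _ => ?_
  rw [inner_apply_right_eq_neg hJ2 hJO, real_inner_comm]
  ring

lemma sum_sum_comp_mul (e : OrthonormalBasis (Fin n) ℝ E) {J : E →ₗ[ℝ] E}
    (hJ2 : ∀ x, J (J x) = -x) (hJO : ∀ x y, ⟪J x, J y⟫ = ⟪x, y⟫) (A B : E →ₗ[ℝ] E →ₗ[ℝ] ℝ) :
    ∑ i, ∑ j, A (J (e i)) (J (e j)) * B (e i) (e j) =
      ∑ i, ∑ j, A (e i) (e j) * B (J (e i)) (J (e j)) := by
  simp only [sum_comp_mul_eq_neg e hJ2 hJO (A _) (B _)]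
  rw [sum_neg_distrib, sum_comm]
  have h (j : Fin n) := sum_comp_mul_eq_neg e hJ2 hJO (A.flip (e j)) (B.flip (J (e j)))
  simp only [LinearMap.flip_apply] at h
  simp only [h, sum_neg_distrib, neg_neg]
  exact sum_comm

/-- A `J`-invariant and a `J`-anti-invariant bilinear form contract to zero. -/
lemma sum_sum_mul_eq_zero (e : OrthonormalBasis (Fin n) ℝ E) {J : E →ₗ[ℝ] E}
    (hJ2 : ∀ x, J (J x) = -x) (hJO : ∀ x y, ⟪J x, J y⟫ = ⟪x, y⟫) {A B : E →ₗ[ℝ] E →ₗ[ℝ] ℝ}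
    (hA : ∀ x y, A (J x) (J y) = A x y) (hB : ∀ x y, B (J x) (J y) = -B x y) :
    ∑ i, ∑ j, A (e i) (e j) * B (e i) (e j) = 0 := by
  have h := sum_sum_comp_mul e hJ2 hJO A B
  simp only [hA, hB, mul_neg, sum_neg_distrib] at h
  linarith

/-- `hatOp` of a 4-linear form, bundled as a bilinear form. -/
def hatBilin (e : OrthonormalBasis (Fin n) ℝ E) (Q : E →ₗ[ℝ] E →ₗ[ℝ] E →ₗ[ℝ] E →ₗ[ℝ] ℝ)
    (γ : E → E → ℝ) : E →ₗ[ℝ] E →ₗ[ℝ] ℝ :=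
  (1 / 2 : ℝ) • ∑ i, ∑ j, γ (e i) (e j) • Q (e i) (e j)

lemma hatOp_eq_hatBilin (e : OrthonormalBasis (Fin n) ℝ E)
    (Q : E →ₗ[ℝ] E →ₗ[ℝ] E →ₗ[ℝ] E →ₗ[ℝ] ℝ) (γ : E → E → ℝ) :
    hatOp e (fun a b c x => Q a b c x) γ = fun x y => hatBilin e Q γ x y := by
  funext x y
  simp [hatOp, hatBilin, LinearMap.sum_apply, mul_comm]

lemma hatOp_comp_right (e : OrthonormalBasis (Fin n) ℝ E)
    {Q : E → E → E → E → ℝ} {J : E → E} {c : ℝ} (hQ : CurvType Q)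
    (hQJ : ∀ x y z w, Q (J x) (J y) z w = c * Q x y z w) (γ : E → E → ℝ) (x y : E) :
    hatOp e Q γ (J x) (J y) = c * hatOp e Q γ x y := by
  have h (a b : E) : Q a b (J x) (J y) = c * Q a b x y := by
    rw [← hQ.2.2, hQJ, hQ.2.2]
  simp only [hatOp, h, mul_assoc, ← mul_sum]
  ring

lemma hatOp_swap (e : OrthonormalBasis (Fin n) ℝ E) {Q : E → E → E → E → ℝ}
    (hQ : CurvType Q) (γ : E → E → ℝ) (x y : E) : hatOp e Q γ y x = -hatOp e Q γ x y := by
  simp only [hatOp, fun a b => hQ.2.1 a b x y, neg_mul, sum_neg_distrib, mul_neg]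

lemma qMinus_kulk_gF {J : E →ₗ[ℝ] E} (hJ2 : ∀ x, J (J x) = -x)
    (hJO : ∀ x y, ⟪J x, J y⟫ = ⟪x, y⟫) (x y z w : E) :
    qMinus J (kulk gF gF) x y z w = ⟪x, z⟫ * ⟪y, w⟫ - ⟪x, w⟫ * ⟪y, z⟫
      - (⟪x, J z⟫ * ⟪y, J w⟫ - ⟪x, J w⟫ * ⟪y, J z⟫) := by
  have h (a b : E) : ⟪J a, b⟫ = -⟪a, J b⟫ := by
    rw [inner_apply_right_eq_neg hJ2 hJO, neg_neg]
  simp only [qMinus, kulk, symProd, gF, hJO]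
  simp only [h]
  ring

/-- The form `(g⊠g)^-` acts as `2` on `J`-anti-invariant 2-forms. -/
lemma hatOp_qMinus_kulk_gF (e : OrthonormalBasis (Fin n) ℝ E) {J : E →ₗ[ℝ] E}
    (hJ2 : ∀ x, J (J x) = -x) (hJO : ∀ x y, ⟪J x, J y⟫ = ⟪x, y⟫) {B : E →ₗ[ℝ] E →ₗ[ℝ] ℝ}
    (hBswap : ∀ x y, B y x = -B x y) (hBJ : ∀ x y, B (J x) (J y) = -B x y) (x y : E) :
    hatOp e (qMinus J (kulk gF gF)) (fun a b => B a b) x y = 2 * B x y := by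
  simp only [hatOp, qMinus_kulk_gF hJ2 hJO, sub_mul, sum_sub_distrib, sum_sum_inner_mul_apply]
  rw [hBJ, hBJ, hBswap x y]
  ring

end Contraction

theorem stmt14 [NormedAddCommGroup V] [InnerProductSpace ℝ V]
    {d : ℕ} (hd : 1 ≤ d) (e : OrthonormalBasis (Fin (2*d)) ℝ V)
    (J : V →ₗ[ℝ] V) (hJ2 : ∀ X : V, J (J X) = -X)
    (hJO : ∀ X Y : V, ⟪J X, J Y⟫ = ⟪X, Y⟫)
    (P Q : V →ₗ[ℝ] V →ₗ[ℝ] V →ₗ[ℝ] V →ₗ[ℝ] ℝ)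
    (hP : CurvType (fun a b c x => P a b c x))
    (hQ : CurvType (fun a b c x => Q a b c x))
    (hPJ : ∀ X Y Z W : V, P (J X) (J Y) Z W = P X Y Z W)
    (hQJ : ∀ X Y Z W : V, Q (J X) (J Y) Z W = - Q X Y Z W) :
    ∀ γ : V → V → ℝ, (∀ X Y : V, γ Y X = - γ X Y) →
      (∀ X Y : V,
        hatOp e (fun a b c x => P a b c x)
          (hatOp e (fun a b c x => Q a b c x) γ) X Y = 0) ∧
      (∀ X Y : V,
        hatOp e (fun a b c x => Q a b c x)
          (hatOp e (fun a b c x => P a b c x) γ) X Y = 0) ∧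
      (∀ X Y : V,
        hatOp e (qMinus J (kulk gF gF))
          (hatOp e (fun a b c x => Q a b c x) γ) X Y
          = 2 * hatOp e (fun a b c x => Q a b c x) γ X Y) := by
  intro γ _
  have hPJ' (X Y : V) : hatBilin e P γ (J X) (J Y) = hatBilin e P γ X Y := by
    have h := hatOp_comp_right e (J := J) (c := 1) hP (by simpa using hPJ) γ X Y
    simpa only [hatOp_eq_hatBilin, one_mul] using h
  have hQJ' (X Y : V) : hatBilin e Q γ (J X) (J Y) = -hatBilin e Q γ X Y := by
    have h := hatOp_comp_right e (J := J) (c := -1) hQ (by simpa using hQJ) γ X Y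
    simpa only [hatOp_eq_hatBilin, neg_one_mul] using h
  have hQswap (X Y : V) : hatBilin e Q γ Y X = -hatBilin e Q γ X Y := by
    simpa only [hatOp_eq_hatBilin] using hatOp_swap e hQ γ X Y
  refine ⟨fun X Y => ?_, fun X Y => ?_, fun X Y => ?_⟩
  · have hPs (a b : V) : P a b X Y = P X Y a b := hP.2.2 X Y a b
    have hA (a b : V) : P X Y (J a) (J b) = P X Y a b := by
      rw [← hPs, hPJ, hPs]
    rw [hatOp_eq_hatBilin e Q γ]
    simp only [hatOp, hPs, sum_sum_mul_eq_zero e hJ2 hJO hA hQJ', mul_zero]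
  · have hQs (a b : V) : Q a b X Y = Q X Y a b := hQ.2.2 X Y a b
    have hA (a b : V) : Q X Y (J a) (J b) = -Q X Y a b := by
      rw [← hQs, hQJ, hQs]
    rw [hatOp_eq_hatBilin e P γ]
    simp only [hatOp, hQs, mul_comm (Q X Y _ _), sum_sum_mul_eq_zero e hJ2 hJO hPJ' hA, mul_zero]
  · rw [hatOp_eq_hatBilin e Q γ]
    exact hatOp_qMinus_kulk_gF e hJ2 hJO hQswap hQJ' X Y

end Stmt
end
end
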